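/- Let B : EuclideanSpace ℝ (Fin q) → ((EuclideanSpace ℝ (Fin k)) →ₗ[ℝ] (EuclideanSpace ℝ (Fin q))) be smooth (ContDiff ℝ ⊤), with associated affine planes P_y and linear maps A y. Assume: (i) for every y, the bilinear map (ξ, w) ↦ (fderiv ℝ A y ξ) w from ℝ^q × (ℝ^k × ℝ) to ℝ^q is nonsingular; (ii) for every sequence (y_j) with ‖y_j‖ → ∞, Metric.infDist 0 (P_{y_j}) → ∞. Then the planes P_y, y ∈ ℝ^q, are pairwise skew and their union is all of (EuclideanSpace ℝ (Fin k)) × (EuclideanSpace ℝ (Fin q)). -/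

import Mathlib

open Metric Module Filter

/-- The affine `k`-plane `P_y = {(t, B y t + y) : t}` associated to a map
`B` into the space of linear maps. -/
noncomputable def plane {q k : ℕ}
    (B : EuclideanSpace ℝ (Fin q) → (EuclideanSpace ℝ (Fin k) →ₗ[ℝ] EuclideanSpace ℝ (Fin q)))
    (y : EuclideanSpace ℝ (Fin q)) :
    AffineSubspace ℝ (EuclideanSpace ℝ (Fin k) × EuclideanSpace ℝ (Fin q)) :=
  AffineSubspace.mk' (0, y) (LinearMap.graph (B y))

/-- The linear map `A y : (t, λ) ↦ B y t + λ • y`, as a continuous linear map. -/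
noncomputable def Amap {q k : ℕ}
    (B : EuclideanSpace ℝ (Fin q) → (EuclideanSpace ℝ (Fin k) →ₗ[ℝ] EuclideanSpace ℝ (Fin q)))
    (y : EuclideanSpace ℝ (Fin q)) :
    (EuclideanSpace ℝ (Fin k) × ℝ) →L[ℝ] EuclideanSpace ℝ (Fin q) :=
  LinearMap.toContinuousLinearMap
    ((B y).comp (LinearMap.fst ℝ (EuclideanSpace ℝ (Fin k)) ℝ) +
      (LinearMap.snd ℝ (EuclideanSpace ℝ (Fin k)) ℝ).smulRight y)

/-- A `C¹` self-map of a finite-dimensional space whose derivative at `a` is injective is a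
local homeomorphism at `a`. -/
theorem ContDiff.exists_openPartialHomeomorph_of_fderiv_injective {E : Type*}
    [NormedAddCommGroup E] [NormedSpace ℝ E] [FiniteDimensional ℝ E] {f : E → E}
    (hf : ContDiff ℝ 1 f) {a : E} (ha : Function.Injective (fderiv ℝ f a)) :
    ∃ e : OpenPartialHomeomorph E E, a ∈ e.source ∧ ⇑e = f := by
  have : CompleteSpace E := FiniteDimensional.complete ℝ E
  let L : E ≃L[ℝ] E :=
    (LinearEquiv.ofInjectiveEndo (fderiv ℝ f a : E →ₗ[ℝ] E) ha).toContinuousLinearEquiv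
  have hL : (L : E →L[ℝ] E) = fderiv ℝ f a := by ext v; rfl
  have hs : HasStrictFDerivAt f (L : E →L[ℝ] E) a :=
    hL ▸ hf.contDiffAt.hasStrictFDerivAt one_ne_zero
  exact ⟨hs.toOpenPartialHomeomorph f, hs.mem_toOpenPartialHomeomorph_source,
    hs.toOpenPartialHomeomorph_coe⟩

/-- **Hadamard's global inverse theorem**: a proper local homeomorphism of a finite-dimensional
real normed space to itself is bijective. -/
theorem IsLocalHomeomorph.bijective_of_isProperMap {E : Type*}
    [NormedAddCommGroup E] [NormedSpace ℝ E] [FiniteDimensional ℝ E] {f : E → E}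
    (hf : IsLocalHomeomorph f) (hp : IsProperMap f) : Function.Bijective f := by
  have hcov : IsCoveringMap f := by
    rw [isCoveringMap_iff_isCoveringMapOn_univ]
    refine hp.isClosedMap.isCoveringMapOn_of_isLocalHomeomorphOn (fun x _ => ?_)
      (hf.isLocalHomeomorphOn.mono (Set.subset_univ _))
    refine (hp.isCompact_preimage isCompact_singleton).finite
      (IsLocalHomeomorphOn.isDiscrete_of_image (hf.isLocalHomeomorphOn.mono
        (Set.subset_univ _)) ?_)
    exact (Set.subsingleton_singleton.anti (Set.image_preimage_subset f {x})).isDiscrete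
  constructor
  · intro x y hxy
    obtain ⟨F, ⟨hFx, hF⟩, -⟩ :=
      hcov.existsUnique_continuousMap_lifts (ContinuousMap.id E) (f x) x rfl
    have hFf : F ∘ f = id := hcov.eq_of_comp_eq (F.continuous.comp hf.continuous) continuous_id
      (by rw [← Function.comp_assoc, hF]; rfl) x hFx
    rw [← hFx, hxy]
    exact congrFun hFf y
  · rw [← Set.range_eq_univ]
    exact IsClopen.eq_univ ⟨hp.isClosedMap.isClosed_range, hf.isOpenMap.isOpen_range⟩
      (Set.range_nonempty f)

section SkewFibration

variable {q k : ℕ}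
  {B : EuclideanSpace ℝ (Fin q) → (EuclideanSpace ℝ (Fin k) →ₗ[ℝ] EuclideanSpace ℝ (Fin q))}

theorem Amap_apply (y : EuclideanSpace ℝ (Fin q)) (w : EuclideanSpace ℝ (Fin k) × ℝ) :
    Amap B y w = B y w.1 + w.2 • y := rfl

theorem mem_plane_iff {y : EuclideanSpace ℝ (Fin q)}
    {p : EuclideanSpace ℝ (Fin k) × EuclideanSpace ℝ (Fin q)} :
    p ∈ plane B y ↔ Amap B y (p.1, 1) = p.2 := by
  simp [plane, AffineSubspace.mem_mk', LinearMap.mem_graph_iff, Amap_apply, sub_eq_iff_eq_add,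
    eq_comm]

theorem contDiff_Amap
    (hB : ContDiff ℝ (⊤ : ℕ∞) fun y => LinearMap.toContinuousLinearMap (B y)) :
    ContDiff ℝ 1 (Amap B) := by
  have h : Amap B = fun y => (LinearMap.toContinuousLinearMap (B y)).comp
      (ContinuousLinearMap.fst ℝ (EuclideanSpace ℝ (Fin k)) ℝ) +
      ContinuousLinearMap.smulRightL ℝ (EuclideanSpace ℝ (Fin k) × ℝ) (EuclideanSpace ℝ (Fin q))
        (ContinuousLinearMap.snd ℝ (EuclideanSpace ℝ (Fin k)) ℝ) y :=
    funext fun y => ContinuousLinearMap.ext fun w => rfl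
  rw [h]
  exact ((hB.of_le (by exact_mod_cast le_top)).clm_comp contDiff_const).add
    (ContinuousLinearMap.contDiff _)

theorem fderiv_Amap_apply_const (hA : ContDiff ℝ 1 (Amap B)) (y ξ : EuclideanSpace ℝ (Fin q))
    (w : EuclideanSpace ℝ (Fin k) × ℝ) :
    fderiv ℝ (fun y => Amap B y w) y ξ = fderiv ℝ (Amap B) y ξ w := by
  rw [((hA.differentiable one_ne_zero y).hasFDerivAt.clm_apply (hasFDerivAt_const w y)).fderiv]
  simp

theorem isLocalHomeomorph_Amap_apply (hA : ContDiff ℝ 1 (Amap B))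
    (hnonsing : ∀ y : EuclideanSpace ℝ (Fin q),
      ∀ (ξ : EuclideanSpace ℝ (Fin q)) (w : EuclideanSpace ℝ (Fin k) × ℝ),
        (fderiv ℝ (Amap B) y) ξ w = 0 → ξ = 0 ∨ w = 0)
    {w : EuclideanSpace ℝ (Fin k) × ℝ} (hw : w ≠ 0) :
    IsLocalHomeomorph fun y => Amap B y w := by
  intro y
  obtain ⟨e, he, h⟩ :=
    (hA.clm_apply contDiff_const).exists_openPartialHomeomorph_of_fderiv_injective (a := y)
    ((injective_iff_map_eq_zero _).2 fun ξ hξ => (hnonsing y ξ w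
      ((fderiv_Amap_apply_const hA y ξ w).symm.trans hξ)).resolve_right hw)
  exact ⟨e, he, h.symm⟩

theorem isProperMap_Amap_apply_one (hA : ContDiff ℝ 1 (Amap B))
    (hproper : ∀ yseq : ℕ → EuclideanSpace ℝ (Fin q),
      Tendsto (fun j => ‖yseq j‖) atTop atTop →
      Tendsto (fun j =>
        infDist 0 (plane B (yseq j) : Set (EuclideanSpace ℝ (Fin k) × EuclideanSpace ℝ (Fin q))))
        atTop atTop) (t : EuclideanSpace ℝ (Fin k)) :
    IsProperMap fun y => Amap B y (t, 1) := by
  have hc : Continuous fun y => Amap B y (t, 1) := by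
    have := hA.continuous
    fun_prop
  rw [isProperMap_iff_tendsto_cocompact]
  refine ⟨hc, ?_⟩
  rw [← cobounded_eq_cocompact, ← tendsto_norm_atTop_iff_cobounded, ← comap_norm_atTop,
    tendsto_iff_seq_tendsto]
  intro u hu
  rw [tendsto_comap_iff] at hu
  refine tendsto_atTop_mono (fun j => ?_)
    (tendsto_atTop_add_const_right _ (-‖t‖) (hproper u hu))
  have hmem : (t, Amap B (u j) (t, 1)) ∈ plane B (u j) := mem_plane_iff.2 rfl
  rw [← sub_eq_add_neg, sub_le_iff_le_add']
  refine (infDist_le_dist_of_mem hmem).trans ?_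
  rw [dist_zero_left, Prod.norm_def]
  exact max_le_add_of_nonneg (norm_nonneg _) (norm_nonneg _)

open Topology in
/-- Near `s = 0`, the family `y ↦ A y (t, s)` with `t ≠ 0` is locally a family of homeomorphisms. -/
theorem map_nhds_prodMk_Amap (hA : ContDiff ℝ 1 (Amap B))
    (hnonsing : ∀ y : EuclideanSpace ℝ (Fin q),
      ∀ (ξ : EuclideanSpace ℝ (Fin q)) (w : EuclideanSpace ℝ (Fin k) × ℝ),
        (fderiv ℝ (Amap B) y) ξ w = 0 → ξ = 0 ∨ w = 0)
    {t : EuclideanSpace ℝ (Fin k)} (ht : t ≠ 0) (y : EuclideanSpace ℝ (Fin q)) :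
    map (fun p : ℝ × EuclideanSpace ℝ (Fin q) => (p.1, Amap B p.2 (t, p.1))) (𝓝 (0, y)) =
      𝓝 (0, Amap B y (t, 0)) := by
  have hH : ContDiff ℝ 1
      fun p : ℝ × EuclideanSpace ℝ (Fin q) => (p.1, Amap B p.2 (t, p.1)) :=
    contDiff_fst.prodMk ((hA.comp contDiff_snd).clm_apply (contDiff_const.prodMk contDiff_fst))
  have hinj : Function.Injective (fderiv ℝ
      (fun p : ℝ × EuclideanSpace ℝ (Fin q) => (p.1, Amap B p.2 (t, p.1))) (0, y)) := by
    have hw : HasFDerivAt (fun p : ℝ × EuclideanSpace ℝ (Fin q) => (t, p.1)) _ (0, y) :=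
      (hasFDerivAt_const t _).prodMk (hasFDerivAt_fst (𝕜 := ℝ))
    have hA' : HasFDerivAt (fun p : ℝ × EuclideanSpace ℝ (Fin q) => Amap B p.2) _ (0, y) :=
      HasFDerivAt.comp (g := Amap B) (f := Prod.snd) ((0 : ℝ), y)
        (hA.differentiable one_ne_zero y).hasFDerivAt hasFDerivAt_snd
    have hd := (hasFDerivAt_fst (𝕜 := ℝ) (p := ((0 : ℝ), y))).prodMk (hA'.clm_apply hw)
    refine (injective_iff_map_eq_zero _).2 fun v hv => ?_
    have hv' := (DFunLike.congr_fun hd.fderiv v).symm.trans hv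
    obtain ⟨σ, ξ⟩ := v
    simp only [ContinuousLinearMap.prod_apply, Prod.mk_eq_zero] at hv'
    obtain ⟨rfl : σ = 0, h2⟩ := hv'
    have h3 : fderiv ℝ (Amap B) y ξ (t, 0) = 0 := by simpa [Amap_apply] using h2
    rcases hnonsing y ξ _ h3 with h | h
    · simp [h]
    · exact absurd (congrArg Prod.fst h) ht
  obtain ⟨e, he, h⟩ := hH.exists_openPartialHomeomorph_of_fderiv_injective hinj
  rw [← h, e.map_nhds_eq he, h]

open Topology in
/-- Injectivity of `y ↦ A y (t, s)` for `s ≠ 0` passes to the limit `s = 0`, because any two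
coinciding values at `s = 0` persist for small `s`. -/
theorem injective_Amap_apply_zero (hA : ContDiff ℝ 1 (Amap B))
    (hnonsing : ∀ y : EuclideanSpace ℝ (Fin q),
      ∀ (ξ : EuclideanSpace ℝ (Fin q)) (w : EuclideanSpace ℝ (Fin k) × ℝ),
        (fderiv ℝ (Amap B) y) ξ w = 0 → ξ = 0 ∨ w = 0)
    (hinj : ∀ t : EuclideanSpace ℝ (Fin k), Function.Injective fun y => Amap B y (t, 1))
    {t : EuclideanSpace ℝ (Fin k)} (ht : t ≠ 0) :
    Function.Injective fun y => Amap B y (t, 0) := by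
  intro x y (hxy : Amap B x (t, 0) = Amap B y (t, 0))
  by_contra hne
  have hscale (s : ℝ) (hs : s ≠ 0) (z : EuclideanSpace ℝ (Fin q)) :
      Amap B z (t, s) = s • Amap B z (s⁻¹ • t, 1) := by
    simp [← map_smul, hs]
  obtain ⟨U, V, hU, hV, hxU, hyV, hUV⟩ := t2_separation hne
  have key (z : EuclideanSpace ℝ (Fin q)) {W : Set (EuclideanSpace ℝ (Fin q))} (hW : W ∈ 𝓝 z) :
      ∀ᶠ s in 𝓝 (0 : ℝ), ∃ z' ∈ W, Amap B z' (t, s) = Amap B z (t, 0) := by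
    have h := image_mem_map (m := fun p : ℝ × EuclideanSpace ℝ (Fin q) =>
      (p.1, Amap B p.2 (t, p.1))) (prod_mem_nhds (univ_mem (f := 𝓝 (0 : ℝ))) hW)
    rw [map_nhds_prodMk_Amap hA hnonsing ht z] at h
    have hc : ContinuousAt (fun s : ℝ => (s, Amap B z (t, 0))) 0 := by fun_prop
    filter_upwards [hc h] with s hs
    obtain ⟨⟨s', z'⟩, ⟨-, hz'⟩, hsz⟩ := hs
    obtain ⟨rfl : s' = s, h'⟩ := Prod.mk.inj hsz
    exact ⟨z', hz', h'⟩
  obtain ⟨s, ⟨⟨x', hx', hxs⟩, y', hy', hys⟩, hs⟩ :=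
    ((((key x (hU.mem_nhds hxU)).and (key y (hV.mem_nhds hyV))).filter_mono
      nhdsWithin_le_nhds).and (self_mem_nhdsWithin (a := (0 : ℝ)) (s := {0}ᶜ))).exists
  have hs : s ≠ 0 := hs
  have h : Amap B x' (t, s) = Amap B y' (t, s) := by rw [hxs, hys, hxy]
  rw [hscale s hs, hscale s hs] at h
  have : x' = y' := hinj _ (smul_right_injective _ hs h)
  exact hUV.ne_of_mem hx' hy' this

end SkewFibration

theorem nondegenerate_proper_gives_skew_fibration (q k : ℕ)
    (B : EuclideanSpace ℝ (Fin q) → (EuclideanSpace ℝ (Fin k) →ₗ[ℝ] EuclideanSpace ℝ (Fin q)))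
    (hB : ContDiff ℝ (⊤ : ℕ∞) fun y => LinearMap.toContinuousLinearMap (B y))
    (hnonsing : ∀ y : EuclideanSpace ℝ (Fin q),
      ∀ (ξ : EuclideanSpace ℝ (Fin q)) (w : EuclideanSpace ℝ (Fin k) × ℝ),
        (fderiv ℝ (Amap B) y) ξ w = 0 → ξ = 0 ∨ w = 0)
    (hproper : ∀ yseq : ℕ → EuclideanSpace ℝ (Fin q),
      Tendsto (fun j => ‖yseq j‖) atTop atTop →
      Tendsto (fun j =>
        infDist 0 (plane B (yseq j) : Set (EuclideanSpace ℝ (Fin k) × EuclideanSpace ℝ (Fin q))))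
        atTop atTop) :
    (∀ x y : EuclideanSpace ℝ (Fin q), x ≠ y →
        Disjoint (plane B x : Set (EuclideanSpace ℝ (Fin k) × EuclideanSpace ℝ (Fin q)))
          (plane B y : Set (EuclideanSpace ℝ (Fin k) × EuclideanSpace ℝ (Fin q))) ∧
        (plane B x).direction ⊓ (plane B y).direction = ⊥) ∧
      (∀ p : EuclideanSpace ℝ (Fin k) × EuclideanSpace ℝ (Fin q),
        ∃ y : EuclideanSpace ℝ (Fin q), p ∈ plane B y) := by
  have hA := contDiff_Amap hB
  have hbij (t : EuclideanSpace ℝ (Fin k)) : Function.Bijective fun y => Amap B y (t, 1) :=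
    (isLocalHomeomorph_Amap_apply hA hnonsing (by simp)).bijective_of_isProperMap
      (isProperMap_Amap_apply_one hA hproper t)
  refine ⟨fun x y hne => ⟨Set.disjoint_left.2 fun p hx hy => hne ?_, ?_⟩, fun p => ?_⟩
  · exact (hbij p.1).1 ((mem_plane_iff.1 hx).trans (mem_plane_iff.1 hy).symm)
  · simp only [plane, AffineSubspace.direction_mk']
    refine (Submodule.eq_bot_iff _).2 fun v ⟨hx, hy⟩ => ?_
    obtain ⟨t, z⟩ := v
    have hx : z = B x t := hx
    have hy : z = B y t := hy
    rcases eq_or_ne t 0 with rfl | ht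
    · simp [hx]
    · exact absurd (injective_Amap_apply_zero hA hnonsing (fun t => (hbij t).1) ht
        (by simp [Amap_apply, ← hx, ← hy])) hne
  · obtain ⟨y, hy⟩ := (hbij p.1).2 p.2
    exact ⟨y, mem_plane_iff.2 hy⟩
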